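/- arXiv:1701.00346 — 2 statements merged into one kernel-verified Lean document; each statement's English description precedes it below -/
import Mathlib

section
/- Let t > 1 be a real number and let a, b be natural numbers. Then M_{2a+b,b}(t) < C(t) · t^{(2a+b)²/2 − a²}, where C(t) = Σ_{k=0}^∞ P(k) t^{−2k}. -/
noncomputable section

open Finset

/-- Height of the path `w` (of length `L`, up = `true`, down = `false`) after `i` steps. -/
def height {L : ℕ} (w : Fin L → Bool) (i : ℕ) : ℤ :=
  ∑ j ∈ Finset.univ.filter (fun j : Fin L => (j : ℕ) < i),
    (if w j then (1 : ℤ) else -1)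

/-- `DyckSet a b`: the set `D_{a,b}` of paths of length `2a+b` with `a+b` up steps whose
heights stay nonnegative. -/
def DyckSet (a b : ℕ) : Finset (Fin (2 * a + b) → Bool) :=
  Finset.univ.filter (fun w =>
    (Finset.univ.filter (fun j => w j = true)).card = a + b ∧
      ∀ i ≤ 2 * a + b, 0 ≤ height w i)

/-- The area `A(w)` between the path `w` and the x-axis. -/
def area {L : ℕ} (w : Fin L → Bool) : ℝ :=
  (∑ i ∈ Finset.range L, ((height w i + height w (i + 1) : ℤ) : ℝ)) / 2

/-- The weighted path sum `M_{2a+b,b}(t) = Σ_{w ∈ D_{a,b}} t^{A(w)}`. -/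
def M (a b : ℕ) (t : ℝ) : ℝ := ∑ w ∈ DyckSet a b, t ^ area w

/-- `M_{ℓ,m}(t)` for `ℓ ≥ m` with `ℓ - m` even. -/
def Mlm (ℓ m : ℕ) (t : ℝ) : ℝ := M ((ℓ - m) / 2) m t

/-- `P k`: the number of partitions of `k`. -/
def P (k : ℕ) : ℕ := Fintype.card (Nat.Partition k)

/-- `C(t) = Σ_{k=0}^∞ P(k) t^{-2k}`. -/
def C (t : ℝ) : ℝ := ∑' k : ℕ, (P k : ℝ) * t ^ (-(2 : ℝ) * k)

/-- For every down step of a path, the number of up steps following it. -/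
def upsAfterDowns : List Bool → Multiset ℕ
  | [] => 0
  | true :: l => upsAfterDowns l
  | false :: l => l.count true ::ₘ upsAfterDowns l

theorem le_count_of_mem_upsAfterDowns {l : List Bool} {n : ℕ} (hn : n ∈ upsAfterDowns l) :
    n ≤ l.count true := by
  induction l with
  | nil => simp [upsAfterDowns] at hn
  | cons x l ih =>
    cases x with
    | true => exact (ih hn).trans (by simp)
    | false =>
      rcases Multiset.mem_cons.1 hn with rfl | hn
      · simp
      · simpa using ih hn

theorem upsAfterDowns_filter_ne {l m : List Bool}
    (h : (false :: l).count true = (true :: m).count true) :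
    (upsAfterDowns (false :: l)).filter (· ≠ 0) ≠ (upsAfterDowns (true :: m)).filter (· ≠ 0) := by
  intro he
  simp only [List.count_cons_self, List.count_cons_of_ne, ne_eq, reduceCtorEq,
    not_false_eq_true] at h
  have hmem : l.count true ∈ (upsAfterDowns (true :: m)).filter (· ≠ 0) := by
    rw [← he]
    simp [upsAfterDowns, h]
  have := le_count_of_mem_upsAfterDowns (l := m) (Multiset.mem_of_mem_filter hmem)
  omega

/-- A path is determined by its length, its number of up steps and the nonzero elements of
`upsAfterDowns`. -/
theorem eq_of_upsAfterDowns_filter_eq {l m : List Bool} (hlen : l.length = m.length)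
    (hcount : l.count true = m.count true)
    (h : (upsAfterDowns l).filter (· ≠ 0) = (upsAfterDowns m).filter (· ≠ 0)) : l = m := by
  induction l generalizing m with
  | nil => exact (List.length_eq_zero_iff.1 hlen.symm).symm
  | cons x l ih =>
    cases m with
    | nil => simp at hlen
    | cons y m =>
      have hlen' : l.length = m.length := by simpa using hlen
      cases x <;> cases y
      · have hc : l.count true = m.count true := by simpa using hcount
        rw [ih hlen' hc]
        simp only [upsAfterDowns, hc, Multiset.filter_cons] at h
        exact add_left_cancel h
      · exact absurd h (upsAfterDowns_filter_ne hcount)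
      · exact absurd h.symm (upsAfterDowns_filter_ne hcount.symm)
      · rw [ih hlen' (by simpa using hcount) h]

theorem count_true_ofFn {L : ℕ} (w : Fin L → Bool) :
    (List.ofFn w).count true = (univ.filter (fun j => w j = true)).card := by
  induction L with
  | zero => simp
  | succ L ih =>
    rw [List.ofFn_succ, Fin.card_filter_univ_succ, List.count_cons, ih]
    cases w 0 <;> simp

theorem height_zero {L : ℕ} (w : Fin L → Bool) : height w 0 = 0 := by
  simp [height]

theorem height_succ {L : ℕ} (w : Fin (L + 1) → Bool) (i : ℕ) :
    height w (i + 1) = (if w 0 then 1 else -1) + height (fun j => w j.succ) i := by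
  simp [height, Finset.sum_filter, Fin.sum_univ_succ]

theorem area_succ {L : ℕ} (w : Fin (L + 1) → Bool) :
    area w = (if w 0 then 1 else -1) * (L + 1 / 2) + area (fun j => w j.succ) := by
  simp only [area, Finset.sum_range_succ', height_succ, height_zero]
  push_cast
  simp only [Finset.sum_add_distrib, Finset.sum_const, Finset.card_range, nsmul_eq_mul]
  ring

theorem area_eq {L : ℕ} (w : Fin L → Bool) :
    area w = (L : ℝ) ^ 2 / 2 - ((L : ℝ) - (List.ofFn w).count true) ^ 2
      - 2 * ((upsAfterDowns (List.ofFn w)).sum : ℕ) := by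
  induction L with
  | zero => simp [area, upsAfterDowns]
  | succ L ih =>
    rw [area_succ, ih, List.ofFn_succ]
    cases w 0 <;> simp [upsAfterDowns] <;> ring

theorem card_filter_sum_upsAfterDowns_le (a b k : ℕ) :
    ((DyckSet a b).filter (fun w => (upsAfterDowns (List.ofFn w)).sum = k)).card ≤ P k := by
  rw [P, ← Finset.card_univ]
  refine Finset.card_le_card_of_injOn
    (fun w => if hw : (upsAfterDowns (List.ofFn w)).sum = k then Nat.Partition.ofSums k _ hw
      else Nat.Partition.indiscrete k) (by simp) ?_
  intro v hv w hw h
  simp only [DyckSet, Finset.coe_filter, Finset.mem_filter, Set.mem_ofPred_eq] at hv hw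
  simp only [hv.2, hw.2, dif_pos] at h
  refine List.ofFn_injective (eq_of_upsAfterDowns_filter_eq (by simp) ?_
    (congrArg Nat.Partition.parts h))
  rw [count_true_ofFn, count_true_ofFn, hv.1.2.1, hw.1.2.1]

/-- The pairs (part, multiplicity) of a partition. -/
def partMultiplicities (p : Σ k, Nat.Partition k) : Finset (ℕ × ℕ) :=
  p.2.parts.toFinset.image (fun i => (i, p.2.parts.count i))

theorem partMultiplicities_injective : Function.Injective partMultiplicities := by
  have key (p q : Σ k, Nat.Partition k) (h : partMultiplicities p = partMultiplicities q) :
      p.2.parts ≤ q.2.parts := by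
    rw [Multiset.le_iff_count]
    intro i
    by_cases hi : i ∈ p.2.parts
    · have : (i, p.2.parts.count i) ∈ partMultiplicities q := by
        rw [← h]
        exact Finset.mem_image_of_mem _ (Multiset.mem_toFinset.2 hi)
      obtain ⟨j, -, hj⟩ := Finset.mem_image.1 this
      obtain ⟨rfl, hj⟩ := Prod.mk.inj hj
      exact hj.ge
    · simp [hi]
  rintro ⟨k, p⟩ ⟨m, q⟩ h
  have hpq : p.parts = q.parts := le_antisymm (key _ _ h) (key _ _ h.symm)
  obtain rfl : k = m := by rw [← p.parts_sum, ← q.parts_sum, hpq]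
  rw [Nat.Partition.ext hpq]

theorem summable_card_partition_mul_pow {q : ℝ} (hq0 : 0 < q) (hq1 : q < 1) :
    Summable (fun k => (P k : ℝ) * q ^ k) := by
  let f : ℕ × ℕ → ℝ := fun x => if 0 < x.1 ∧ 0 < x.2 then q ^ (x.1 * x.2) else 0
  have hf0 : 0 ≤ f := fun x => by
    dsimp only [f, Pi.zero_apply]
    split_ifs <;> positivity
  have hgeom := summable_geometric_of_lt_one hq0.le hq1
  have hf : Summable f := by
    refine Summable.of_nonneg_of_le hf0 (fun x => ?_)
      ((hgeom.mul_of_nonneg hgeom (fun _ => by positivity) fun _ => by positivity).mul_left q⁻¹)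
    dsimp only [f]
    split_ifs with hx
    · rw [← pow_add, inv_mul_eq_div, le_div_iff₀ hq0, ← pow_succ]
      refine pow_le_pow_of_le_one hq0.le hq1.le ?_
      nlinarith [Nat.mul_le_mul hx.1 hx.2, hx.1, hx.2]
    · positivity
  have hs := (summable_finsetProd_of_summable_nonneg hf0 hf).comp_injective
    partMultiplicities_injective
  have hprod (p : Σ k, Nat.Partition k) : ∏ x ∈ partMultiplicities p, f x = q ^ p.1 := by
    rw [partMultiplicities, Finset.prod_image fun i _ j _ h => (Prod.mk.inj h).1]
    have : ∀ i ∈ p.2.parts.toFinset, f (i, p.2.parts.count i) = q ^ (p.2.parts.count i * i) := by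
      intro i hi
      rw [Multiset.mem_toFinset] at hi
      simp only [f]
      rw [if_pos ⟨p.2.parts_pos hi, Multiset.count_pos.2 hi⟩, mul_comm]
    rw [Finset.prod_congr rfl this, Finset.prod_pow_eq_pow_sum]
    congr 1
    conv_rhs => rw [← p.2.parts_sum, Finset.sum_multiset_count]
    simp
  simp only [Function.comp_def, hprod] at hs
  have := hs.sigma
  simpa [P, tsum_fintype] using this

/-- Lemma 1 (upper bound): for `t > 1`, `M_{2a+b,b}(t) < C(t) t^{(2a+b)²/2 - a²}`. -/
theorem stmt_1 (t : ℝ) (ht : 1 < t) (a b : ℕ) :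
    M a b t < C t * t ^ (((2 * a + b : ℕ) : ℝ) ^ 2 / 2 - (a : ℝ) ^ 2) := by
  have ht0 : 0 < t := by linarith
  set q : ℝ := t ^ (-2 : ℝ) with hq
  have hq0 : 0 < q := by positivity
  have hq1 : q < 1 := Real.rpow_lt_one_of_one_lt_of_neg ht (by norm_num)
  have hqk (k : ℕ) : t ^ (-(2 : ℝ) * k) = q ^ k := by
    rw [Real.rpow_mul ht0.le, Real.rpow_natCast]
  let s : (Fin (2 * a + b) → Bool) → ℕ := fun w => (upsAfterDowns (List.ofFn w)).sum
  have hweight : ∀ w ∈ DyckSet a b,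
      t ^ area w = q ^ s w * t ^ (((2 * a + b : ℕ) : ℝ) ^ 2 / 2 - (a : ℝ) ^ 2) := by
    intro w hw
    rw [← hqk, ← Real.rpow_add ht0, area_eq, count_true_ofFn, (Finset.mem_filter.1 hw).2.1]
    congr 1
    simp only [s]
    push_cast
    ring
  rw [M, Finset.sum_congr rfl hweight, ← Finset.sum_mul]
  refine mul_lt_mul_of_pos_right ?_ (by positivity)
  simp only [C, hqk]
  have hsum := summable_card_partition_mul_pow hq0 hq1
  have hpos (k : ℕ) : 0 < (P k : ℝ) * q ^ k := by
    have : 0 < P k := Fintype.card_pos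
    positivity
  obtain ⟨k, hk⟩ := Infinite.exists_notMem_finset ((DyckSet a b).image s)
  calc ∑ w ∈ DyckSet a b, q ^ s w
      = ∑ k ∈ (DyckSet a b).image s, ∑ w ∈ DyckSet a b with s w = k, q ^ s w :=
        (Finset.sum_fiberwise_of_maps_to (fun w hw => Finset.mem_image_of_mem s hw) _).symm
    _ ≤ ∑ k ∈ (DyckSet a b).image s, (P k : ℝ) * q ^ k := by
        refine Finset.sum_le_sum fun k _ => ?_
        rw [Finset.sum_congr rfl fun w hw => by rw [(Finset.mem_filter.1 hw).2],
          Finset.sum_const, nsmul_eq_mul]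
        gcongr
        exact card_filter_sum_upsAfterDowns_le a b k
    _ < ∑ k ∈ insert k ((DyckSet a b).image s), (P k : ℝ) * q ^ k := by
        rw [Finset.sum_insert hk]
        exact lt_add_of_pos_left _ (hpos k)
    _ ≤ ∑' k, (P k : ℝ) * q ^ k := hsum.sum_le_tsum _ fun _ _ => (hpos _).le
end
end

section
/- Let t > 1 be a real number and n ≥ 1 an integer. Then M_{2n−1,1}(t) · t^{3/2} / M_{2n,2}(t) < C(t) · t^{−2n+2}. (This bounds the energy expectation value of the variational excited state of the deformed Fredkin chain, proving that the finite-size gap is at most O(t^{−2n}).) -/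
noncomputable section

open Finset

/-- Adjoin a part of size `d + 1` to a partition. -/
def addPart (d : ℕ) (p : Σ k, Nat.Partition k) : Σ k, Nat.Partition k :=
  ⟨(d + 1) + p.1, (d + 1) ::ₘ p.2.parts, by
    intro i hi
    rcases Multiset.mem_cons.1 hi with rfl | h
    · omega
    · exact p.2.parts_pos h, by rw [Multiset.sum_cons, p.2.parts_sum]⟩

lemma sigma_partition_ext {p p' : Σ k, Nat.Partition k} (h : p.2.parts = p'.2.parts) :
    p = p' := by
  obtain ⟨k, p⟩ := p
  obtain ⟨k', p'⟩ := p'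
  have hk : k = k' := by rw [← p.parts_sum, ← p'.parts_sum]; exact congrArg _ h
  subst hk
  congr 1
  exact Nat.Partition.ext h

lemma addPart_injective (d : ℕ) : Function.Injective (addPart d) := by
  intro p p' h
  have h2 := congrArg (fun x : Σ k, Nat.Partition k => x.2.parts) h
  exact sigma_partition_ext ((Multiset.cons_inj_right _).1 h2)

lemma sum_count_partition {N : ℕ} (p : Σ k, Nat.Partition k) (hp : p.1 < N) :
    ∑ i : Fin N, p.2.parts.count (i + 1 : ℕ) * (i + 1 : ℕ) = p.1 := by
  have hsub : p.2.parts.toFinset ⊆ Finset.range (N + 1) := by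
    intro x hx
    have := Multiset.single_le_sum (fun _ _ => Nat.zero_le _) x (Multiset.mem_toFinset.1 hx)
    rw [p.2.parts_sum] at this
    simp only [Finset.mem_range]
    omega
  have h := Finset.sum_multiset_count_of_subset _ _ hsub
  rw [p.2.parts_sum, Finset.sum_range_succ'] at h
  rw [Fin.sum_univ_eq_sum_range (fun i => p.2.parts.count (i + 1) * (i + 1)) N]
  simpa using h.symm

lemma sum_partition_le_prod {q : ℝ} (hq : 0 < q) {N : ℕ} (s : Finset (Σ k, Nat.Partition k))
    (hs : ∀ p ∈ s, p.1 < N) :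
    ∑ p ∈ s, q ^ p.1 ≤ ∏ i : Fin N, ∑ j ∈ Finset.range N, (q ^ (i + 1 : ℕ)) ^ j := by
  classical
  let e : (Σ k, Nat.Partition k) → Fin N → ℕ := fun p i => p.2.parts.count (i + 1 : ℕ)
  rw [Finset.prod_univ_sum]
  have hval : ∀ p ∈ s, q ^ p.1 = ∏ i : Fin N, (q ^ (i + 1 : ℕ)) ^ (e p i) := by
    intro p hp
    simp_rw [← pow_mul]
    rw [Finset.prod_pow_eq_pow_sum]
    congr 1
    rw [← sum_count_partition p (hs p hp)]
    exact Finset.sum_congr rfl fun i _ => mul_comm _ _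
  have hinj : Set.InjOn e s := by
    intro p hp p' hp' h
    apply sigma_partition_ext
    ext x
    rcases x with _ | x
    · rw [Multiset.count_eq_zero_of_notMem, Multiset.count_eq_zero_of_notMem]
      · exact fun h0 => absurd (p'.2.parts_pos h0) (lt_irrefl _)
      · exact fun h0 => absurd (p.2.parts_pos h0) (lt_irrefl _)
    · by_cases hx : x < N
      · exact congrFun h ⟨x, hx⟩
      · have aux : ∀ r ∈ s, r.2.parts.count (x + 1) = 0 := by
          intro r hr
          rw [Multiset.count_eq_zero]
          intro hm
          have := Multiset.single_le_sum (fun _ _ => Nat.zero_le _) _ hm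
          rw [r.2.parts_sum] at this
          have := hs r hr
          omega
        rw [aux p hp, aux p' hp']
  rw [Finset.sum_congr rfl hval,
    ← Finset.sum_image (f := fun x : Fin N → ℕ => ∏ i : Fin N, (q ^ (i + 1 : ℕ)) ^ (x i)) hinj]
  apply Finset.sum_le_sum_of_subset_of_nonneg
  · intro x hx
    obtain ⟨p, hp, rfl⟩ := Finset.mem_image.1 hx
    rw [Fintype.mem_piFinset]
    intro i
    rw [Finset.mem_range]
    have h1 := sum_count_partition p (hs p hp)
    have h2 : e p i * (i + 1) ≤ p.1 := by
      rw [← h1]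
      exact Finset.single_le_sum (f := fun i : Fin N => p.2.parts.count (i + 1 : ℕ) * (i + 1 : ℕ))
        (fun _ _ => Nat.zero_le _) (Finset.mem_univ i)
    have h3 := hs p hp
    nlinarith
  · intro x _ _
    positivity

lemma prod_geom_sum_le {q : ℝ} (hq : 0 < q) (hq1 : q < 1) (N : ℕ) :
    ∏ i : Fin N, ∑ j ∈ Finset.range N, (q ^ (i + 1 : ℕ)) ^ j
      ≤ Real.exp ((1 - q)⁻¹ * (1 - q)⁻¹) := by
  have h1 : ∀ i : Fin N, ∑ j ∈ Finset.range N, (q ^ (i + 1 : ℕ)) ^ j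
      ≤ Real.exp (q ^ (i : ℕ) * (1 - q)⁻¹) := by
    intro i
    have hy0 : 0 < q ^ (i + 1 : ℕ) := by positivity
    have hyq : q ^ (i + 1 : ℕ) ≤ q := pow_le_of_le_one hq.le hq1.le (by omega)
    have hyi : q ^ (i + 1 : ℕ) ≤ q ^ (i : ℕ) := pow_le_pow_of_le_one hq.le hq1.le (by omega)
    set y := q ^ (i + 1 : ℕ)
    have hy1 : y < 1 := hyq.trans_lt hq1
    calc ∑ j ∈ Finset.range N, y ^ j ≤ ∑' j, y ^ j :=
          (summable_geometric_of_lt_one hy0.le hy1).sum_le_tsum _ (fun _ _ => by positivity)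
      _ = (1 - y)⁻¹ := tsum_geometric_of_lt_one hy0.le hy1
      _ = y * (1 - y)⁻¹ + 1 := by
          have : 1 - y ≠ 0 := by linarith
          field_simp
          ring
      _ ≤ Real.exp (y * (1 - y)⁻¹) := Real.add_one_le_exp _
      _ ≤ _ := by
          apply Real.exp_le_exp.2
          have h0 : 0 < 1 - q := by linarith
          have h2 : (1 - y)⁻¹ ≤ (1 - q)⁻¹ := inv_anti₀ h0 (by linarith)
          have h3 : 0 ≤ (1 - y)⁻¹ := inv_nonneg.2 (by linarith)
          exact mul_le_mul hyi h2 h3 (by positivity)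
  calc _ ≤ ∏ i : Fin N, Real.exp (q ^ (i : ℕ) * (1 - q)⁻¹) :=
        Finset.prod_le_prod (fun _ _ => by positivity) (fun i _ => h1 i)
    _ = Real.exp ((∑ i ∈ Finset.range N, q ^ i) * (1 - q)⁻¹) := by
        rw [← Real.exp_sum, ← Finset.sum_mul, Fin.sum_univ_eq_sum_range (fun i => q ^ i) N]
    _ ≤ _ := by
        apply Real.exp_le_exp.2
        apply mul_le_mul_of_nonneg_right _ (inv_nonneg.2 (by linarith))
        rw [← tsum_geometric_of_lt_one hq.le hq1]
        exact (summable_geometric_of_lt_one hq.le hq1).sum_le_tsum _ (fun _ _ => by positivity)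

lemma summable_sigma_partition {q : ℝ} (hq : 0 < q) (hq1 : q < 1) :
    Summable fun p : Σ k, Nat.Partition k => q ^ p.1 := by
  refine summable_of_sum_le (c := Real.exp ((1 - q)⁻¹ * (1 - q)⁻¹))
    (fun _ => by positivity) fun s => ?_
  exact (sum_partition_le_prod hq (N := s.sup (fun p => p.1) + 1) s
    (fun p hp => Nat.lt_succ_of_le (Finset.le_sup (f := fun p => p.1) hp))).trans
      (prod_geom_sum_le hq hq1 _)

open Classical in
/-- The term of `p` in the generating function of the partitions with all parts at most `d`. -/
def boundedPartTerm (q : ℝ) (d : ℕ) (p : Σ k, Nat.Partition k) : ℝ :=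
  if ∀ x ∈ p.2.parts, x ≤ d then q ^ p.1 else 0

/-- The generating function of the partitions with all parts at most `d`. -/
def boundedPartSum (q : ℝ) (d : ℕ) : ℝ := ∑' p, boundedPartTerm q d p

lemma boundedPartTerm_nonneg {q : ℝ} (hq : 0 < q) (d : ℕ) (p : Σ k, Nat.Partition k) :
    0 ≤ boundedPartTerm q d p := by
  unfold boundedPartTerm
  split_ifs <;> positivity

lemma boundedPartTerm_le {q : ℝ} (hq : 0 < q) (d : ℕ) (p : Σ k, Nat.Partition k) :
    boundedPartTerm q d p ≤ q ^ p.1 := by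
  unfold boundedPartTerm
  split_ifs
  · exact le_rfl
  · positivity

lemma summable_boundedPartTerm {q : ℝ} (hq : 0 < q) (hq1 : q < 1) (d : ℕ) :
    Summable (boundedPartTerm q d) :=
  Summable.of_nonneg_of_le (boundedPartTerm_nonneg hq d) (boundedPartTerm_le hq d)
    (summable_sigma_partition hq hq1)

lemma boundedPartTerm_mono {q : ℝ} (hq : 0 < q) (d : ℕ) (p : Σ k, Nat.Partition k) :
    boundedPartTerm q d p ≤ boundedPartTerm q (d + 1) p := by
  by_cases h : ∀ x ∈ p.2.parts, x ≤ d
  · have h' : ∀ x ∈ p.2.parts, x ≤ d + 1 := fun x hx => (h x hx).trans (Nat.le_succ d)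
    simp only [boundedPartTerm, if_pos h, if_pos h', le_refl]
  · simp only [boundedPartTerm, if_neg h]
    exact boundedPartTerm_nonneg hq _ _

lemma one_le_boundedPartSum {q : ℝ} (hq : 0 < q) (hq1 : q < 1) (d : ℕ) :
    1 ≤ boundedPartSum q d := by
  have h := (summable_boundedPartTerm hq hq1 d).le_tsum
    (⟨0, 0, by simp, by simp⟩ : Σ k, Nat.Partition k) (fun p _ => boundedPartTerm_nonneg hq d p)
  simpa [boundedPartTerm, boundedPartSum] using h

lemma boundedPartSum_succ_ge {q : ℝ} (hq : 0 < q) (hq1 : q < 1) (d : ℕ) :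
    boundedPartSum q d + q ^ (d + 1) * boundedPartSum q (d + 1) ≤ boundedPartSum q (d + 1) := by
  have hs := summable_boundedPartTerm hq hq1
  have hsub := (hs (d + 1)).sub (hs d)
  have key : q ^ (d + 1) * boundedPartSum q (d + 1)
      ≤ ∑' p, (boundedPartTerm q (d + 1) p - boundedPartTerm q d p) := by
    rw [boundedPartSum, ← tsum_mul_left]
    refine Summable.tsum_le_tsum_of_inj (addPart d) (addPart_injective d)
      (fun p _ => sub_nonneg.2 (boundedPartTerm_mono hq d p)) (fun p => ?_)
      ((hs (d + 1)).mul_left _) hsub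
    have h1 : ¬ ∀ x ∈ (addPart d p).2.parts, x ≤ d := fun h => by
      have := h (d + 1) (Multiset.mem_cons_self _ _)
      omega
    have h2 : (∀ x ∈ (addPart d p).2.parts, x ≤ d + 1) ↔ ∀ x ∈ p.2.parts, x ≤ d + 1 := by
      simp [addPart]
    simp only [boundedPartTerm, if_neg h1, h2, sub_zero]
    split_ifs
    · rw [← pow_add]
      exact le_rfl
    · simp
  rw [(hs (d + 1)).tsum_sub (hs d)] at key
  change _ ≤ boundedPartSum q (d + 1) - boundedPartSum q d at key
  linarith

lemma boundedPartSum_lt_C {t : ℝ} (ht : 1 < t) (d : ℕ) :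
    boundedPartSum (t ^ (-(2 : ℝ))) d < C t := by
  have ht0 : 0 < t := by linarith
  set q := t ^ (-(2 : ℝ)) with hqdef
  have hq : 0 < q := by positivity
  have hq1 : q < 1 := Real.rpow_lt_one_of_one_lt_of_neg ht (by norm_num)
  have hC : C t = ∑' p : Σ k, Nat.Partition k, q ^ p.1 := by
    rw [(summable_sigma_partition hq hq1).tsum_sigma]
    unfold C
    refine tsum_congr fun k => ?_
    rw [tsum_fintype, Real.rpow_mul ht0.le, Real.rpow_natCast, ← hqdef]
    simp [P]
  rw [hC]
  refine Summable.tsum_lt_tsum (i := ⟨d + 1, {d + 1}, by simp, by simp⟩)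
    (boundedPartTerm_le hq d) ?_ (summable_boundedPartTerm hq hq1 d) (summable_sigma_partition hq hq1)
  simp [boundedPartTerm]
  positivity

lemma height_snoc {L : ℕ} (w : Fin L → Bool) (b : Bool) {i : ℕ} (hi : i ≤ L) :
    height (Fin.snoc w b : Fin (L + 1) → Bool) i = height w i := by
  unfold height
  rw [Finset.sum_filter, Finset.sum_filter, Fin.sum_univ_castSucc]
  have : ¬ L < i := by omega
  simp [this]

lemma height_self {L : ℕ} (w : Fin L → Bool) :
    height w L = 2 * ((Finset.univ.filter (fun j => w j = true)).card : ℤ) - L := by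
  unfold height
  rw [Finset.filter_true_of_mem (fun j _ => j.2), Finset.card_filter]
  push_cast
  rw [Finset.mul_sum]
  have : (L : ℤ) = ∑ j : Fin L, (1 : ℤ) := by simp
  rw [this, ← Finset.sum_sub_distrib]
  refine Finset.sum_congr rfl fun j _ => ?_
  split_ifs <;> norm_num

lemma card_snoc {L : ℕ} (w : Fin L → Bool) (b : Bool) :
    (Finset.univ.filter (fun j => (Fin.snoc w b : Fin (L + 1) → Bool) j = true)).card
      = (Finset.univ.filter (fun j => w j = true)).card + if b then 1 else 0 := by
  rw [Finset.card_filter, Finset.card_filter, Fin.sum_univ_castSucc]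
  simp

lemma area_snoc {L : ℕ} (w : Fin L → Bool) (b : Bool) :
    area (Fin.snoc w b : Fin (L + 1) → Bool)
      = area w + (height w L : ℝ) + (if b then 1 else -1) / 2 := by
  have h1 := height_self (Fin.snoc w b : Fin (L + 1) → Bool)
  have h2 := height_self w
  rw [card_snoc] at h1
  have h3 : height (Fin.snoc w b : Fin (L + 1) → Bool) (L + 1)
      = height w L + if b then 1 else -1 := by
    rw [h1, h2]
    push_cast
    split_ifs <;> ring
  unfold area
  rw [Finset.sum_range_succ, h3, height_snoc w b le_rfl]
  have : ∀ i ∈ Finset.range L,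
      (((height (Fin.snoc w b : Fin (L + 1) → Bool) i
        + height (Fin.snoc w b : Fin (L + 1) → Bool) (i + 1) : ℤ) : ℝ))
      = ((height w i + height w (i + 1) : ℤ) : ℝ) := by
    intro i hi
    rw [Finset.mem_range] at hi
    rw [height_snoc w b (by omega), height_snoc w b (by omega)]
  rw [Finset.sum_congr rfl this]
  push_cast
  split_ifs <;> ring

/-- The weighted sum over all paths of length `L` with `u` up steps, of arbitrary heights. -/
def freePathSum (t : ℝ) (L u : ℕ) : ℝ :=
  ∑ w : Fin L → Bool, if (Finset.univ.filter (fun j => w j = true)).card = u then t ^ area w else 0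

lemma freePathSum_succ (t : ℝ) (L u : ℕ) :
    freePathSum t (L + 1) u
      = (∑ w : Fin L → Bool, if (Finset.univ.filter (fun j => w j = true)).card + 1 = u then
          t ^ (area w + height w L + 1 / 2) else 0)
        + ∑ w : Fin L → Bool, if (Finset.univ.filter (fun j => w j = true)).card = u then
          t ^ (area w + height w L - 1 / 2) else 0 := by
  unfold freePathSum
  rw [← (Fin.snocEquiv (fun _ : Fin (L + 1) => Bool)).sum_comp, Fintype.sum_prod_type,
    Fintype.sum_bool]
  have key : ∀ (b : Bool) (w : Fin L → Bool),
      (Fin.snocEquiv (fun _ : Fin (L + 1) => Bool)) (b, w) = Fin.snoc w b := fun _ _ => rfl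
  simp only [key, card_snoc, area_snoc]
  simp [neg_div, sub_eq_add_neg]

lemma sum_ite_area_add {t : ℝ} (ht : 0 < t) (L u : ℕ) (c : ℝ) :
    (∑ w : Fin L → Bool, if (Finset.univ.filter (fun j => w j = true)).card = u then
      t ^ (area w + height w L + c) else 0) = t ^ (2 * (u : ℝ) - L + c) * freePathSum t L u := by
  unfold freePathSum
  rw [Finset.mul_sum]
  refine Finset.sum_congr rfl fun w _ => ?_
  split_ifs with h
  · rw [height_self, h, ← Real.rpow_add ht]
    push_cast
    ring_nf
  · simp

lemma freePathSum_of_lt (t : ℝ) {L u : ℕ} (h : L < u) : freePathSum t L u = 0 := by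
  unfold freePathSum
  refine Finset.sum_eq_zero fun w _ => if_neg fun hw => ?_
  have := Finset.card_le_univ (Finset.univ.filter (fun j => w j = true))
  rw [hw, Fintype.card_fin] at this
  omega

lemma freePathSum_zero_right {t : ℝ} (ht : 0 < t) (L : ℕ) :
    freePathSum t (L + 1) 0 = t ^ (-(L : ℝ) - 1 / 2) * freePathSum t L 0 := by
  rw [freePathSum_succ]
  simp only [sub_eq_add_neg (_ + _ : ℝ), sum_ite_area_add ht]
  simp [sub_eq_add_neg]

lemma freePathSum_succ_succ {t : ℝ} (ht : 0 < t) (L u : ℕ) :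
    freePathSum t (L + 1) (u + 1)
      = t ^ (2 * (u : ℝ) - L + 1 / 2) * freePathSum t L u
        + t ^ (2 * ((u : ℝ) + 1) - L - 1 / 2) * freePathSum t L (u + 1) := by
  rw [freePathSum_succ]
  simp only [sub_eq_add_neg (_ + _ : ℝ), sum_ite_area_add ht, Nat.add_right_cancel_iff]
  simp [sub_eq_add_neg]

lemma freePathSum_le {t : ℝ} (ht : 1 < t) (L : ℕ) : ∀ u d : ℕ, u + d = L →
    freePathSum t L u
      ≤ t ^ ((u : ℝ) ^ 2 - ((u : ℝ) - d) ^ 2 / 2) * boundedPartSum (t ^ (-(2 : ℝ))) d := by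
  have ht0 : 0 < t := by linarith
  have hq : 0 < t ^ (-(2 : ℝ)) := by positivity
  have hq1 : t ^ (-(2 : ℝ)) < 1 := Real.rpow_lt_one_of_one_lt_of_neg ht (by norm_num)
  induction L with
  | zero =>
    intro u d h
    obtain ⟨rfl, rfl⟩ : u = 0 ∧ d = 0 := by omega
    have := one_le_boundedPartSum hq hq1 0
    simpa [freePathSum, area] using this
  | succ L ih =>
    intro u d h
    rcases u with _ | u
    · obtain ⟨d, rfl⟩ : ∃ e, d = e + 1 := ⟨d - 1, by omega⟩
      obtain rfl : d = L := by omega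
      have hmono : boundedPartSum (t ^ (-(2 : ℝ))) d ≤ boundedPartSum (t ^ (-(2 : ℝ))) (d + 1) :=
        (summable_boundedPartTerm hq hq1 d).tsum_le_tsum (boundedPartTerm_mono hq d)
          (summable_boundedPartTerm hq hq1 (d + 1))
      rw [freePathSum_zero_right ht0]
      refine (mul_le_mul_of_nonneg_left (ih 0 d (by omega)) (by positivity)).trans ?_
      rw [← mul_assoc, ← Real.rpow_add ht0]
      refine (mul_le_mul_of_nonneg_left hmono (by positivity)).trans (le_of_eq ?_)
      congr 2
      push_cast
      ring
    · rw [freePathSum_succ_succ ht0]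
      have hup := mul_le_mul_of_nonneg_left (ih u d (by omega))
        (by positivity : 0 ≤ t ^ (2 * (u : ℝ) - L + 1 / 2))
      rw [← mul_assoc, ← Real.rpow_add ht0] at hup
      have hL : (L : ℝ) = u + d := by rw [← Nat.cast_add]; congr 1; omega
      rcases d with _ | d
      · rw [freePathSum_of_lt t (by omega : L < u + 1), mul_zero, add_zero]
        refine hup.trans (le_of_eq ?_)
        congr 2
        rw [hL]
        push_cast
        ring
      · have hdown := mul_le_mul_of_nonneg_left (ih (u + 1) d (by omega))
          (by positivity : 0 ≤ t ^ (2 * ((u : ℝ) + 1) - L - 1 / 2))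
        rw [← mul_assoc, ← Real.rpow_add ht0] at hdown
        refine (add_le_add hup hdown).trans ?_
        have hZ := mul_le_mul_of_nonneg_left (boundedPartSum_succ_ge hq hq1 d)
          (by positivity :
            0 ≤ t ^ (((u + 1 : ℕ) : ℝ) ^ 2 - (((u + 1 : ℕ) : ℝ) - (d + 1 : ℕ)) ^ 2 / 2))
        refine le_trans (le_of_eq ?_) hZ
        rw [mul_add (t ^ _), add_comm (t ^ _ * _), ← mul_assoc (t ^ _), ← Real.rpow_natCast (t ^ (-(2 : ℝ))) (d + 1),
          ← Real.rpow_mul ht0.le, ← Real.rpow_add ht0]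
        congr 3 <;> rw [hL] <;> push_cast <;> ring

lemma M_one_le {t : ℝ} (ht : 1 < t) (a : ℕ) :
    M a 1 t ≤ t ^ (((a : ℝ) + 1) ^ 2 - 1 / 2) * boundedPartSum (t ^ (-(2 : ℝ))) a := by
  have h := freePathSum_le ht (2 * a + 1) (a + 1) a (by omega)
  refine le_trans ?_ (h.trans (le_of_eq ?_))
  · unfold M freePathSum DyckSet
    rw [← Finset.sum_filter]
    refine Finset.sum_le_sum_of_subset_of_nonneg (fun w hw => ?_) (fun w _ _ => ?_)
    · simp only [Finset.mem_filter] at hw ⊢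
      exact ⟨hw.1, hw.2.1⟩
    · have : 0 < t := by linarith
      positivity
  · congr 2
    push_cast
    ring

/-- The path with `m` up steps followed by down steps. -/
def peakPath (L m : ℕ) : Fin L → Bool := fun j => decide ((j : ℕ) < m)

lemma height_peakPath {L m i : ℕ} (hi : i ≤ L) :
    height (peakPath L m) i = if i ≤ m then (i : ℤ) else 2 * m - i := by
  have h0 : height (peakPath L m) i = ∑ j ∈ Finset.range i, if j < m then (1 : ℤ) else -1 := by
    unfold height peakPath
    refine Finset.sum_bij (fun j _ => (j : ℕ)) (by simp) (fun _ _ _ _ h => Fin.ext h)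
      (fun j hj => ⟨⟨j, by simp at hj; omega⟩, by simpa using hj, rfl⟩) (by simp)
  rw [h0]
  clear h0 hi
  induction i with
  | zero => simp
  | succ i ih =>
    rw [Finset.sum_range_succ, ih]
    push_cast
    split_ifs <;> omega

lemma sum_height_peakPath_up {L m : ℕ} (hm : m ≤ L) {k : ℕ} (hk : k ≤ m) :
    ∑ i ∈ Finset.range k, (height (peakPath L m) i + height (peakPath L m) (i + 1))
      = (k : ℤ) ^ 2 := by
  induction k with
  | zero => simp
  | succ k ih =>
    rw [Finset.sum_range_succ, ih (by omega), height_peakPath (by omega),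
      height_peakPath (by omega), if_pos (by omega), if_pos (by omega)]
    push_cast
    ring

lemma sum_height_peakPath {L m : ℕ} {k : ℕ} (hk : m + k ≤ L) :
    ∑ i ∈ Finset.range (m + k), (height (peakPath L m) i + height (peakPath L m) (i + 1))
      = 2 * (m : ℤ) ^ 2 - ((m : ℤ) - k) ^ 2 := by
  induction k with
  | zero =>
    rw [add_zero, sum_height_peakPath_up (by omega) le_rfl]
    push_cast
    ring
  | succ k ih =>
    rw [← add_assoc, Finset.sum_range_succ, ih (by omega), height_peakPath (by omega),
      height_peakPath (by omega), if_neg (by omega : ¬ m + k + 1 ≤ m)]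
    split_ifs with h
    · obtain rfl : k = 0 := by omega
      push_cast
      ring
    · push_cast
      ring

lemma le_M_two {t : ℝ} (ht : 0 < t) (a : ℕ) : t ^ (((a : ℝ) + 2) ^ 2 - 2) ≤ M a 2 t := by
  have hmem : peakPath (2 * a + 2) (a + 2) ∈ DyckSet a 2 := by
    refine Finset.mem_filter.2 ⟨Finset.mem_univ _, ?_, fun i hi => ?_⟩
    · have h := height_self (peakPath (2 * a + 2) (a + 2))
      rw [height_peakPath le_rfl] at h
      push_cast at h
      split_ifs at h <;> omega
    · rw [height_peakPath hi]
      push_cast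
      split_ifs <;> omega
  have harea : area (peakPath (2 * a + 2) (a + 2)) = ((a : ℝ) + 2) ^ 2 - 2 := by
    unfold area
    rw [← Int.cast_sum, show 2 * a + 2 = (a + 2) + a by ring, sum_height_peakPath le_rfl]
    push_cast
    ring
  rw [← harea]
  exact Finset.single_le_sum (f := fun w => t ^ area w) (fun w _ => by positivity) hmem

/-- Finite-size gap bound: for `t > 1`,
`M_{2n-1,1}(t) t^{3/2} / M_{2n,2}(t) < C(t) t^{-2n+2}`. -/
theorem stmt_9 (t : ℝ) (ht : 1 < t) (n : ℕ) (hn : 1 ≤ n) :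
    Mlm (2 * n - 1) 1 t * t ^ ((3 : ℝ) / 2) / Mlm (2 * n) 2 t
      < C t * t ^ (-(2 : ℝ) * n + 2) := by
  obtain ⟨a, rfl⟩ : ∃ a, n = a + 1 := ⟨n - 1, by omega⟩
  have ht0 : 0 < t := by linarith
  have h1 : Mlm (2 * (a + 1) - 1) 1 t = M a 1 t := by
    unfold Mlm
    congr 1
    omega
  have h2 : Mlm (2 * (a + 1)) 2 t = M a 2 t := by
    unfold Mlm
    congr 1
    omega
  have hlow := le_M_two ht0 a
  have hpos : 0 < M a 2 t := lt_of_lt_of_le (by positivity) hlow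
  have hZ := boundedPartSum_lt_C ht a
  have hC : 0 < C t := lt_of_le_of_lt (tsum_nonneg (boundedPartTerm_nonneg (by positivity) a)) hZ
  rw [h1, h2, div_lt_iff₀ hpos]
  calc M a 1 t * t ^ ((3 : ℝ) / 2)
      ≤ t ^ (((a : ℝ) + 1) ^ 2 - 1 / 2) * boundedPartSum (t ^ (-(2 : ℝ))) a * t ^ ((3 : ℝ) / 2) :=
        mul_le_mul_of_nonneg_right (M_one_le ht a) (by positivity)
    _ < t ^ (((a : ℝ) + 1) ^ 2 - 1 / 2) * C t * t ^ ((3 : ℝ) / 2) := by gcongr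
    _ = C t * (t ^ (((a : ℝ) + 1) ^ 2 - 1 / 2) * t ^ ((3 : ℝ) / 2)) := by ring
    _ = C t * (t ^ (-(2 : ℝ) * ((a + 1 : ℕ) : ℝ) + 2) * t ^ (((a : ℝ) + 2) ^ 2 - 2)) := by
        rw [← Real.rpow_add ht0, ← Real.rpow_add ht0]
        congr 2
        push_cast
        ring
    _ = C t * t ^ (-(2 : ℝ) * ((a + 1 : ℕ) : ℝ) + 2) * t ^ (((a : ℝ) + 2) ^ 2 - 2) := by ring
    _ ≤ _ := mul_le_mul_of_nonneg_left hlow (by positivity)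
end
end
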